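/- Let γ(β) = ∫₀^∞ log x dν_β(x) for β ∈ (1/2, 1]. For every α with 1/2 < α ≤ 1, the function γ is differentiable at α within (1/2, 1], and its derivative equals γ(α)·(1 + 2α − 2α²)/((2α − 1)(α² − α + 1)) + ((2α − 1)/(α² − α + 1))·∫₀^∞∫₀^∞ log((x + y + xy)/(x + y + 1)) dν_α(x) dν_α(y). -/

import Mathlib

open MeasureTheory Filter Set Topology

noncomputable section

/-- Endpoints (as pairs of nonnegative integers, `(a,b)` representing `a/b`, with `1/0 = ∞`)
of the Stern-Brocot interval obtained from `[0/1, 1/0]` by following the list of choices `w`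
(`true` = left sub-interval, `false` = right sub-interval). -/
def sbGo : (ℕ × ℕ) × (ℕ × ℕ) → List Bool → (ℕ × ℕ) × (ℕ × ℕ)
  | I, [] => I
  | ((a, b), (c, d)), (lft :: w) =>
      if lft then sbGo ((a, b), (a + c, b + d)) w else sbGo ((a + c, b + d), (c, d)) w

/-- The Stern-Brocot interval of rank `w.length` indexed by the list of choices `w`. -/
def sb (w : List Bool) : (ℕ × ℕ) × (ℕ × ℕ) := sbGo ((0, 1), (1, 0)) w

/-- The intersection of a Stern-Brocot interval with `[0, ∞)`, as a subset of `ℝ`. -/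
def sbSet : (ℕ × ℕ) × (ℕ × ℕ) → Set ℝ
  | ((a, b), (c, d)) =>
      if d = 0 then Set.Ici ((a : ℝ) / (b : ℝ))
      else Set.Icc ((a : ℝ) / (b : ℝ)) ((c : ℝ) / (d : ℝ))

/-- `ν` is the measure `ν_α`: a Borel probability measure on `[0,∞)` (viewed as a measure on `ℝ`
giving no mass to `(-∞,0)`) with `ν([0,1]) = 1 - α`, `ν([1,∞)) = α`, and such that for every
Stern-Brocot interval `I` of rank `r ≥ 1`, the left sub-interval of `I` carries a proportion `α`
of the mass of `I` if `r` is odd and `1 - α` if `r` is even. -/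
def IsSternBrocotMeasure (α : ℝ) (ν : Measure ℝ) : Prop :=
  IsProbabilityMeasure ν ∧
  ν (Set.Iio 0) = 0 ∧
  ν (Set.Icc 0 1) = ENNReal.ofReal (1 - α) ∧
  ν (Set.Ici 1) = ENNReal.ofReal α ∧
  ∀ w : List Bool, 1 ≤ w.length →
    ν (sbSet (sb (w ++ [true]))) =
      (if Odd w.length then ENNReal.ofReal α else ENNReal.ofReal (1 - α)) * ν (sbSet (sb w))

/-- The left sub-interval of a Stern-Brocot interval. -/
def sbLeft (I : (ℕ × ℕ) × (ℕ × ℕ)) : (ℕ × ℕ) × (ℕ × ℕ) := (I.1, I.1 + I.2)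

/-- The right sub-interval of a Stern-Brocot interval. -/
def sbRight (I : (ℕ × ℕ) × (ℕ × ℕ)) : (ℕ × ℕ) × (ℕ × ℕ) := (I.1 + I.2, I.2)

/-- The proportion of mass which `ν_α` gives to the left half of an interval of rank `r`. -/
def sbProb (α : ℝ) (r : ℕ) : ℝ := if Odd r then α else 1 - α

/-- The homeomorphism `x ↦ x / (1 + |x|)` from `ℝ` to `(-1, 1)`. -/
def squash (x : ℝ) : ℝ := x / (1 + |x|)

/-- The image under `squash` of the mediant of an interval. -/
def sbMid (I : (ℕ × ℕ) × (ℕ × ℕ)) : ℝ :=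
  ((I.1.1 : ℝ) + I.2.1) / (I.1.1 + I.1.2 + I.2.1 + I.2.2)

/-- The average, with the weights of `ν_α`, of `g ∘ sbMid` over the `n`-th generation descendants
of the interval `I` of rank `r`. -/
def sbAverage (α : ℝ) (g : ℝ → ℝ) : ℕ → ℕ → (ℕ × ℕ) × (ℕ × ℕ) → ℝ
  | 0, _, I => g (sbMid I)
  | n + 1, r, I => sbProb α r * sbAverage α g n (r + 1) (sbLeft I)
      + (1 - sbProb α r) * sbAverage α g n (r + 1) (sbRight I)

/-- `I` satisfies the determinant condition, and its entries are large if its rank `n` is. -/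
def IsSternBrocot (n : ℕ) (I : (ℕ × ℕ) × (ℕ × ℕ)) : Prop :=
  I.1.2 * I.2.1 = I.1.1 * I.2.2 + 1 ∧ n + 2 ≤ I.1.1 + I.1.2 + I.2.1 + I.2.2

lemma sbGo_append (I : (ℕ × ℕ) × (ℕ × ℕ)) (w : List Bool) (x : Bool) :
    sbGo I (w ++ [x]) = if x then sbLeft (sbGo I w) else sbRight (sbGo I w) := by
  induction w generalizing I with
  | nil => obtain ⟨⟨a, b⟩, c, d⟩ := I; cases x <;> rfl
  | cons y w ih => obtain ⟨⟨a, b⟩, c, d⟩ := I; cases y <;> simp [sbGo, ih]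

lemma sb_append_true (w : List Bool) : sb (w ++ [true]) = sbLeft (sb w) := by
  simp [sb, sbGo_append]

lemma sb_append_false (w : List Bool) : sb (w ++ [false]) = sbRight (sb w) := by
  simp [sb, sbGo_append]

lemma le_of_mem_sbSet {I : (ℕ × ℕ) × (ℕ × ℕ)} {x : ℝ} (hx : x ∈ sbSet I) :
    (I.1.1 : ℝ) / I.1.2 ≤ x := by
  obtain ⟨⟨a, b⟩, c, d⟩ := I
  simp only [sbSet] at hx
  split_ifs at hx
  · exact hx
  · exact hx.1

namespace IsSternBrocot

variable {n : ℕ} {I : (ℕ × ℕ) × (ℕ × ℕ)}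

lemma pos (h : IsSternBrocot n I) : 0 < I.1.2 ∧ 0 < I.2.1 := by
  have h1 := h.1
  constructor <;> by_contra! h0 <;> simp_all

lemma left (h : IsSternBrocot n I) : IsSternBrocot (n + 1) (sbLeft I) := by
  have := h.pos
  obtain ⟨h1, h2⟩ := h
  refine ⟨?_, ?_⟩ <;> simp only [sbLeft, Prod.fst_add, Prod.snd_add]
  · linarith
  · omega

lemma right (h : IsSternBrocot n I) : IsSternBrocot (n + 1) (sbRight I) := by
  have := h.pos
  obtain ⟨h1, h2⟩ := h
  refine ⟨?_, ?_⟩ <;> simp only [sbRight, Prod.fst_add, Prod.snd_add]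
  · linarith
  · omega

lemma sb (w : List Bool) : IsSternBrocot w.length (sb w) := by
  induction w using List.reverseRecOn with
  | nil => simp [_root_.sb, sbGo, IsSternBrocot]
  | append_singleton w x ih =>
    cases x
    · rw [sb_append_false]; simpa using ih.right
    · rw [sb_append_true]; simpa using ih.left

lemma sbSet_eq_union (h : IsSternBrocot n I) : sbSet I = sbSet (sbLeft I) ∪ sbSet (sbRight I) := by
  have hp := h.pos
  have h1 := h.1
  obtain ⟨⟨a, b⟩, c, d⟩ := I
  simp only at hp h1
  have hb : (0 : ℝ) < b := by exact_mod_cast hp.1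
  have hd : (0 : ℝ) ≤ d := by positivity
  have h1' : (b : ℝ) * c = a * d + 1 := by exact_mod_cast h1
  have hbd : ¬ (b + d = 0) := by omega
  have hl : (a : ℝ) / b ≤ (a + c) / (b + d) := by
    rw [div_le_div_iff₀ hb (by positivity)]; linarith
  simp only [sbLeft, sbRight, sbSet, Prod.mk_add_mk, hbd, if_false]
  push_cast
  split_ifs with h0
  · rw [Icc_union_Ici_eq_Ici hl]
  · have hd : (0 : ℝ) < d := by positivity
    rw [Icc_union_Icc_eq_Icc hl]
    rw [div_le_div_iff₀ (by positivity) hd]; linarith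

/-- The left end point of an interval. -/
lemma left_mem (h : IsSternBrocot n I) : (I.1.1 : ℝ) / I.1.2 ∈ sbSet I := by
  have hp := h.pos
  have h1 := h.1
  obtain ⟨⟨a, b⟩, c, d⟩ := I
  simp only at hp h1
  have hb : (0 : ℝ) < b := by exact_mod_cast hp.1
  have h1' : (b : ℝ) * c = a * d + 1 := by exact_mod_cast h1
  simp only [sbSet]
  split_ifs with h0
  · simp
  · have hd : (0 : ℝ) < d := by positivity
    refine ⟨le_rfl, ?_⟩
    rw [div_le_div_iff₀ hb hd]; linarith

lemma inter_subset (h : IsSternBrocot n I) :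
    sbSet (sbLeft I) ∩ sbSet (sbRight I) ⊆ {((sbRight I).1.1 : ℝ) / (sbRight I).1.2} := by
  have hp := h.pos
  rintro x ⟨hx, hx'⟩
  refine le_antisymm ?_ (le_of_mem_sbSet hx')
  obtain ⟨⟨a, b⟩, c, d⟩ := I
  have hbd : ¬ (b + d = 0) := by simp only at hp; omega
  simp only [sbLeft, sbSet, Prod.mk_add_mk, hbd, if_false] at hx
  exact hx.2

lemma sbMid_mem (h : IsSternBrocot n I) : sbMid I ∈ Icc (0 : ℝ) 1 := by
  have hp := h.pos
  have : (0 : ℝ) < I.1.2 := by exact_mod_cast hp.1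
  have : (0 : ℝ) < I.2.1 := by exact_mod_cast hp.2
  have : (0 : ℝ) ≤ I.2.2 := by positivity
  refine ⟨by unfold sbMid; positivity, ?_⟩
  unfold sbMid
  rw [div_le_one (by positivity)]
  linarith

/-- In the coordinate `squash`, an interval of rank `n` has length at most `1 / (n + 1)`. -/
lemma abs_squash_sub_le (h : IsSternBrocot n I) {x : ℝ} (hx : x ∈ sbSet I) :
    |squash x - sbMid I| ≤ 1 / (n + 1) := by
  have hp := h.pos
  obtain ⟨h1, h2⟩ := h
  obtain ⟨⟨a, b⟩, c, d⟩ := I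
  simp only at hp h1 h2
  have ha : (0 : ℝ) ≤ a := by positivity
  have hd : (0 : ℝ) ≤ d := by positivity
  have hb : (1 : ℝ) ≤ b := by exact_mod_cast hp.1
  have hc : (1 : ℝ) ≤ c := by exact_mod_cast hp.2
  have h1' : (b : ℝ) * c = a * d + 1 := by exact_mod_cast h1
  have h2' : (n : ℝ) + 2 ≤ a + b + c + d := by exact_mod_cast h2
  have hlow : (a : ℝ) / b ≤ x := le_of_mem_sbSet hx
  have hx0 : 0 ≤ x := le_trans (by positivity) hlow
  have hup : x * d ≤ c := by
    simp only [sbSet] at hx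
    split_ifs at hx with h0
    · simp [h0]
    · have hd : (0 : ℝ) < d := by positivity
      exact (le_div_iff₀ hd).1 hx.2
  rw [div_le_iff₀ (by positivity)] at hlow
  have l1 : (a : ℝ) / (a + b) ≤ squash x := by
    rw [squash, abs_of_nonneg hx0, div_le_div_iff₀ (by positivity) (by positivity)]; nlinarith
  have l2 : squash x ≤ (c : ℝ) / (c + d) := by
    rw [squash, abs_of_nonneg hx0, div_le_div_iff₀ (by positivity) (by positivity)]; nlinarith
  have m1 : (a : ℝ) / (a + b) ≤ sbMid ((a, b), c, d) := by
    rw [sbMid, div_le_div_iff₀ (by positivity) (by positivity)]; nlinarith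
  have m2 : sbMid ((a, b), c, d) ≤ (c : ℝ) / (c + d) := by
    rw [sbMid, div_le_div_iff₀ (by positivity) (by positivity)]; nlinarith
  have hlen : (c : ℝ) / (c + d) - a / (a + b) ≤ 1 / (n + 1) := by
    rw [div_sub_div _ _ (by positivity) (by positivity),
      div_le_div_iff₀ (by positivity) (by positivity)]
    nlinarith [mul_nonneg (by linarith : (0 : ℝ) ≤ a + b - 1) (by linarith : (0 : ℝ) ≤ c + d - 1)]
  rw [abs_le]
  constructor <;> linarith

end IsSternBrocot

lemma sbProb_succ (α : ℝ) (r : ℕ) : sbProb α (r + 1) = 1 - sbProb α r := by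
  unfold sbProb
  by_cases h : Odd r
  · simp [h, Nat.odd_add_one]
  · simp [h, Nat.odd_add_one]

lemma measurableSet_sbSet (I : (ℕ × ℕ) × (ℕ × ℕ)) : MeasurableSet (sbSet I) := by
  obtain ⟨⟨a, b⟩, c, d⟩ := I
  simp only [sbSet]
  split_ifs
  · exact measurableSet_Ici
  · exact measurableSet_Icc

namespace IsSternBrocotMeasure

variable {α : ℝ} {ν : Measure ℝ}

lemma ae_nonneg (h : IsSternBrocotMeasure α ν) : ∀ᵐ x ∂ν, 0 ≤ x := by
  rw [ae_iff]
  simpa [Iio_def] using h.2.1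

lemma real_sb_nil (h : IsSternBrocotMeasure α ν) : ν.real (sbSet (sb [])) = 1 := by
  have := h.1
  have h0 : sbSet (sb []) = Ici 0 := by simp [sb, sbGo, sbSet]
  rw [h0, ← compl_Iio, probReal_compl_eq_one_sub measurableSet_Iio, measureReal_def, h.2.1]
  simp

lemma real_sb_append_true (h : IsSternBrocotMeasure α ν) (hα : α ∈ Icc (0 : ℝ) 1) (w : List Bool) :
    ν.real (sbSet (sb (w ++ [true]))) = sbProb α w.length * ν.real (sbSet (sb w)) := by
  rcases w with _ | ⟨x, w⟩
  · rw [h.real_sb_nil]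
    have h0 : sbSet (sb ([] ++ [true])) = Icc 0 1 := by simp [sb, sbGo, sbSet]
    rw [h0, measureReal_def, h.2.2.1, ENNReal.toReal_ofReal (by linarith [hα.2])]
    simp [sbProb]
  · rw [measureReal_def, h.2.2.2.2 (x :: w) (by simp), ENNReal.toReal_mul, ← measureReal_def]
    congr 1
    unfold sbProb
    split_ifs
    · exact ENNReal.toReal_ofReal hα.1
    · exact ENNReal.toReal_ofReal (by linarith [hα.2])

lemma measure_left_endpoint (h : IsSternBrocotMeasure α ν) (hα : α ∈ Icc (0 : ℝ) 1)
    (w : List Bool) : ν {((sb w).1.1 : ℝ) / (sb w).1.2} = 0 := by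
  have := h.1
  have key : ∀ k : ℕ, ∃ w' : List Bool, (sb w').1 = (sb w).1 ∧
      ν.real (sbSet (sb w')) ≤ (1 / 4) ^ k := by
    intro k
    induction k with
    | zero => exact ⟨w, rfl, by simp⟩
    | succ k ih =>
      obtain ⟨w', h1, h2⟩ := ih
      refine ⟨w' ++ [true] ++ [true], by rw [sb_append_true, sb_append_true]; exact h1, ?_⟩
      rw [h.real_sb_append_true hα, h.real_sb_append_true hα,
        List.length_append, List.length_singleton, sbProb_succ, pow_succ,
        ← mul_assoc, mul_comm ((1 / 4 : ℝ) ^ k)]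
      refine mul_le_mul ?_ h2 (by positivity) (by norm_num)
      nlinarith [sq_nonneg (sbProb α w'.length - 1 / 2)]
  have hle : ν.real {((sb w).1.1 : ℝ) / (sb w).1.2} ≤ 0 := by
    refine ge_of_tendsto' (tendsto_pow_atTop_nhds_zero_of_lt_one (r := (1 / 4 : ℝ))
      (by norm_num) (by norm_num)) fun k => ?_
    obtain ⟨w', h1, h2⟩ := key k
    refine le_trans (measureReal_mono ?_) h2
    rw [← h1, singleton_subset_iff]
    exact (IsSternBrocot.sb w').left_mem
  exact (measureReal_eq_zero_iff).1 (le_antisymm hle measureReal_nonneg)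

lemma aedisjoint (h : IsSternBrocotMeasure α ν) (hα : α ∈ Icc (0 : ℝ) 1) (w : List Bool) :
    AEDisjoint ν (sbSet (sb (w ++ [true]))) (sbSet (sb (w ++ [false]))) := by
  have h0 := h.measure_left_endpoint hα (w ++ [false])
  rw [sb_append_false] at h0
  rw [sb_append_true, sb_append_false]
  exact measure_mono_null (IsSternBrocot.sb w).inter_subset h0

lemma sbSet_eq_union (w : List Bool) :
    sbSet (sb w) = sbSet (sb (w ++ [true])) ∪ sbSet (sb (w ++ [false])) := by
  rw [sb_append_true, sb_append_false]
  exact (IsSternBrocot.sb w).sbSet_eq_union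

lemma real_sb_append_false (h : IsSternBrocotMeasure α ν) (hα : α ∈ Icc (0 : ℝ) 1)
    (w : List Bool) :
    ν.real (sbSet (sb (w ++ [false]))) = (1 - sbProb α w.length) * ν.real (sbSet (sb w)) := by
  have := h.1
  have h1 := measureReal_union₀ (measurableSet_sbSet (sb (w ++ [false]))).nullMeasurableSet
    (h.aedisjoint hα w)
  rw [← sbSet_eq_union, h.real_sb_append_true hα] at h1
  linarith

lemma ae_pos (h : IsSternBrocotMeasure α ν) (hα : α ∈ Icc (0 : ℝ) 1) : ∀ᵐ x ∂ν, 0 < x := by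
  have h0 : ∀ᵐ x ∂ν, x ≠ 0 := by
    rw [ae_iff]
    simpa [sb, sbGo] using h.measure_left_endpoint hα []
  filter_upwards [h.ae_nonneg, h0] with x hx hx0
  exact lt_of_le_of_ne hx hx0.symm

end IsSternBrocotMeasure

lemma squash_of_nonneg {x : ℝ} (hx : 0 ≤ x) : squash x = x / (1 + x) := by
  rw [squash, abs_of_nonneg hx]

lemma squash_mem {x : ℝ} (hx : 0 ≤ x) : squash x ∈ Icc (0 : ℝ) 1 := by
  rw [squash_of_nonneg hx]
  exact ⟨by positivity, by rw [div_le_one (by positivity)]; linarith⟩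

lemma continuous_squash : Continuous squash :=
  continuous_id.div (by fun_prop) fun x => by positivity

lemma squash_leftInverse : Function.LeftInverse (fun t : ℝ => t / (1 - |t|)) squash := by
  intro x
  have h : 0 < 1 + |x| := by positivity
  simp only [squash, abs_div, abs_of_pos h]
  field_simp
  simp

lemma continuous_sbAverage (g : ℝ → ℝ) (n r : ℕ) (I : (ℕ × ℕ) × (ℕ × ℕ)) :
    Continuous fun α => sbAverage α g n r I := by
  induction n generalizing r I with
  | zero => exact continuous_const
  | succ n ih =>
    have hp : Continuous fun α => sbProb α r := by
      unfold sbProb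
      split_ifs <;> fun_prop
    exact (hp.mul (ih _ _)).add ((continuous_const.sub hp).mul (ih _ _))

/-- The effect on `sbAverage` of an orientation-reversing map, given by an additive map `φ` on
pairs and by `S` in the coordinate `squash`. -/
lemma sbAverage_flip {φ : ℕ × ℕ → ℕ × ℕ} {S : ℝ → ℝ} (hφ : ∀ p q, φ (p + q) = φ p + φ q)
    (hS : ∀ n I, IsSternBrocot n I → sbMid (φ I.2, φ I.1) = S (sbMid I))
    (α : ℝ) (g : ℝ → ℝ) (n r : ℕ) {m : ℕ} {I : (ℕ × ℕ) × (ℕ × ℕ)} (hI : IsSternBrocot m I) :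
    sbAverage α g n (r + 1) (φ I.2, φ I.1) = sbAverage α (g ∘ S) n r I := by
  induction n generalizing r I m with
  | zero => simp [sbAverage, hS m I hI]
  | succ n ih =>
    have h1 : sbLeft (φ I.2, φ I.1) = (φ (sbRight I).2, φ (sbRight I).1) := by
      simp [sbLeft, sbRight, hφ, add_comm]
    have h2 : sbRight (φ I.2, φ I.1) = (φ (sbLeft I).2, φ (sbLeft I).1) := by
      simp [sbLeft, sbRight, hφ, add_comm]
    rw [sbAverage, sbAverage, h1, h2, ih _ hI.left, ih _ hI.right, sbProb_succ]
    ring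

lemma sbAverage_succ_sb_nil (α : ℝ) (g : ℝ → ℝ) (n : ℕ) :
    sbAverage α g (n + 1) 0 (sb []) =
      (1 - α) * sbAverage α (g ∘ fun u => (1 - u) / (2 - u)) n 0 (sb [])
        + α * sbAverage α (g ∘ fun u => 1 / (1 + u)) n 0 (sb []) := by
  have hpos : ∀ n I, IsSternBrocot n I →
      (0 : ℝ) < I.1.1 + I.1.2 + I.2.1 + I.2.2 := fun n I hI => by
    have := hI.2
    have h0 : 0 < I.1.1 + I.1.2 + I.2.1 + I.2.2 := by omega
    exact_mod_cast h0
  rw [← sbAverage_flip (φ := fun p => (p.2, p.1 + p.2)) _ _ α g n 0 (IsSternBrocot.sb []),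
    ← sbAverage_flip (φ := fun p => (p.1 + p.2, p.1)) _ _ α g n 0 (IsSternBrocot.sb [])]
  · simp [sbAverage, sbProb, sb, sbGo, sbLeft, sbRight]
  · intro p q
    exact Prod.ext (by simp; ring) rfl
  · intro n I hI
    have := hpos n I hI
    have : (0 : ℝ) ≤ I.1.1 := by positivity
    simp only [sbMid]
    push_cast
    rw [one_add_div (by positivity), one_div_div]
    congr 1 <;> ring
  · intro p q
    exact Prod.ext rfl (by simp; ring)
  · intro n I hI
    have := hpos n I hI
    simp only [sbMid]
    push_cast
    have e1 : 1 - ((I.1.1 : ℝ) + I.2.1) / (I.1.1 + I.1.2 + I.2.1 + I.2.2)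
        = (I.2.2 + I.1.2) / (I.1.1 + I.1.2 + I.2.1 + I.2.2) := by
      field_simp; ring
    have e2 : 2 - ((I.1.1 : ℝ) + I.2.1) / (I.1.1 + I.1.2 + I.2.1 + I.2.2)
        = (I.2.2 + (I.2.1 + I.2.2) + I.1.2 + (I.1.1 + I.1.2))
          / (I.1.1 + I.1.2 + I.2.1 + I.2.2) := by
      field_simp; ring
    rw [e1, e2, div_div_div_cancel_right₀ this.ne']

namespace IsSternBrocotMeasure

variable {α : ℝ} {ν : Measure ℝ}

lemma integrable_comp_squash (h : IsSternBrocotMeasure α ν) {g : ℝ → ℝ}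
    (hg : ContinuousOn g (Icc 0 1)) : Integrable (fun x => g (squash x)) ν := by
  have := h.1
  obtain ⟨C, hC⟩ := isCompact_Icc.exists_bound_of_continuousOn hg
  have hr : ν.restrict (Ici 0) = ν := Measure.restrict_eq_self_of_ae_mem h.ae_nonneg
  refine Integrable.of_bound (C := C) ?_ ?_
  · rw [← hr]
    exact (hg.comp continuous_squash.continuousOn fun x hx =>
      squash_mem hx).aestronglyMeasurable measurableSet_Ici
  · filter_upwards [h.ae_nonneg] with x hx
    exact hC _ (squash_mem hx)

lemma abs_setIntegral_sub_le (h : IsSternBrocotMeasure α ν) (hα : α ∈ Icc (0 : ℝ) 1) {g : ℝ → ℝ}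
    {ε : ℝ} {N : ℕ} (hg : ContinuousOn g (Icc 0 1))
    (hε : ∀ s ∈ Icc (0 : ℝ) 1, ∀ t ∈ Icc (0 : ℝ) 1, |s - t| ≤ 1 / (N + 1) → |g s - g t| ≤ ε)
    (n : ℕ) (w : List Bool) (hN : N ≤ n + w.length) :
    |∫ x in sbSet (sb w), g (squash x) ∂ν
        - ν.real (sbSet (sb w)) * sbAverage α g n w.length (sb w)|
      ≤ ε * ν.real (sbSet (sb w)) := by
  have := h.1
  have hint := h.integrable_comp_squash hg
  induction n generalizing w with
  | zero =>
    rw [zero_add] at hN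
    rw [sbAverage, ← smul_eq_mul (ν.real _), ← setIntegral_const,
      ← integral_sub hint.integrableOn (integrable_const (g (sbMid (sb w)))), ← Real.norm_eq_abs]
    refine norm_setIntegral_le_of_norm_le_const (measure_lt_top ν _) fun x hx => ?_
    have hw := IsSternBrocot.sb w
    have hx0 : 0 ≤ x := le_trans (by positivity) (le_of_mem_sbSet hx)
    refine hε _ (squash_mem hx0) _ hw.sbMid_mem ((hw.abs_squash_sub_le hx).trans ?_)
    gcongr
  | succ n ih =>
    have hl := ih (w ++ [true]) (by simp; omega)
    have hr := ih (w ++ [false]) (by simp; omega)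
    rw [h.real_sb_append_true hα, sb_append_true] at hl
    rw [h.real_sb_append_false hα, sb_append_false] at hr
    have hsplit : ∫ x in sbSet (sb w), g (squash x) ∂ν
        = (∫ x in sbSet (sbLeft (sb w)), g (squash x) ∂ν)
          + ∫ x in sbSet (sbRight (sb w)), g (squash x) ∂ν := by
      rw [sbSet_eq_union, ← sb_append_true, ← sb_append_false]
      exact setIntegral_union₀ (h.aedisjoint hα w)
        (measurableSet_sbSet _).nullMeasurableSet hint.integrableOn hint.integrableOn
    rw [hsplit, sbAverage]
    simp only [List.length_append, List.length_singleton] at hl hr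
    rw [abs_le] at hl hr ⊢
    constructor <;> linarith [hl.1, hl.2, hr.1, hr.2]

end IsSternBrocotMeasure

lemma exists_abs_integral_sub_sbAverage_le {g : ℝ → ℝ} (hg : ContinuousOn g (Icc 0 1)) {ε : ℝ}
    (hε : 0 < ε) : ∃ N, ∀ n ≥ N, ∀ α ∈ Icc (0 : ℝ) 1, ∀ ν, IsSternBrocotMeasure α ν →
      |∫ x, g (squash x) ∂ν - sbAverage α g n 0 (sb [])| ≤ ε := by
  have huc := isCompact_Icc.uniformContinuousOn_of_continuous hg
  obtain ⟨δ, hδ, hd⟩ := Metric.uniformContinuousOn_iff.1 huc ε hε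
  obtain ⟨N, hN⟩ := exists_nat_one_div_lt hδ
  refine ⟨N, fun n hn α hα ν h => ?_⟩
  have key := h.abs_setIntegral_sub_le hα hg (ε := ε) (N := N)
    (fun s hs t ht hst => (hd s hs t ht (hst.trans_lt hN)).le) n [] (by simpa using hn)
  have h0 : sbSet (sb []) = Ici 0 := by simp [sb, sbGo, sbSet]
  rw [h.real_sb_nil, h0, Measure.restrict_eq_self_of_ae_mem (s := Ici 0) h.ae_nonneg] at key
  simpa using key

lemma continuousOn_integral_comp_squash {ν : ℝ → Measure ℝ}
    (hν : ∀ β ∈ Icc (0 : ℝ) 1, IsSternBrocotMeasure β (ν β)) {g : ℝ → ℝ}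
    (hg : ContinuousOn g (Icc 0 1)) :
    ContinuousOn (fun β => ∫ x, g (squash x) ∂(ν β)) (Icc 0 1) := by
  refine TendstoUniformlyOn.continuousOn
    (F := fun n β => sbAverage β g n 0 (sb [])) (p := atTop) ?_
    (Frequently.of_forall fun n => (continuous_sbAverage g n 0 _).continuousOn)
  refine Metric.tendstoUniformlyOn_iff.2 fun ε hε => ?_
  obtain ⟨N, hN⟩ := exists_abs_integral_sub_sbAverage_le hg (half_pos hε)
  filter_upwards [eventually_ge_atTop N] with n hn β hβ
  exact (hN n hn β hβ _ (hν β hβ)).trans_lt (half_lt_self hε)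

namespace IsSternBrocotMeasure

variable {α : ℝ} {ν : Measure ℝ}

lemma tendsto_sbAverage (h : IsSternBrocotMeasure α ν) (hα : α ∈ Icc (0 : ℝ) 1) {g : ℝ → ℝ}
    (hg : ContinuousOn g (Icc 0 1)) :
    Tendsto (fun n => sbAverage α g n 0 (sb [])) atTop (𝓝 (∫ x, g (squash x) ∂ν)) := by
  refine Metric.tendsto_atTop.2 fun ε hε => ?_
  obtain ⟨N, hN⟩ := exists_abs_integral_sub_sbAverage_le hg (half_pos hε)
  refine ⟨N, fun n hn => ?_⟩
  rw [dist_comm]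
  exact (hN n hn α hα _ h).trans_lt (half_lt_self hε)

lemma integral_comp_squash_eq (h : IsSternBrocotMeasure α ν) (hα : α ∈ Icc (0 : ℝ) 1) {g : ℝ → ℝ}
    (hg : ContinuousOn g (Icc 0 1)) :
    ∫ x, g (squash x) ∂ν = (1 - α) * ∫ x, g (squash (1 + x)⁻¹) ∂ν
      + α * ∫ x, g (squash (1 + x⁻¹)) ∂ν := by
  have h1 : ContinuousOn (g ∘ fun u : ℝ => (1 - u) / (2 - u)) (Icc 0 1) := by
    refine hg.comp (ContinuousOn.div (by fun_prop) (by fun_prop) fun u hu => ?_) fun u hu => ?_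
    · linarith [hu.2]
    · have : 0 < 2 - u := by linarith [hu.2]
      exact ⟨div_nonneg (by linarith [hu.2]) this.le, by rw [div_le_one this]; linarith [hu.1]⟩
  have h2 : ContinuousOn (g ∘ fun u : ℝ => 1 / (1 + u)) (Icc 0 1) := by
    refine hg.comp (ContinuousOn.div (by fun_prop) (by fun_prop) fun u hu => ?_) fun u hu => ?_
    · linarith [hu.1]
    · have : 0 < 1 + u := by linarith [hu.1]
      exact ⟨by positivity, by rw [div_le_one this]; linarith [hu.1]⟩
  have hlim := ((h.tendsto_sbAverage hα h1).const_mul (1 - α)).add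
    ((h.tendsto_sbAverage hα h2).const_mul α)
  have hlim' := (h.tendsto_sbAverage hα hg).comp (tendsto_add_atTop_nat 1)
  simp only [Function.comp_def, sbAverage_succ_sb_nil] at hlim hlim'
  rw [tendsto_nhds_unique hlim' hlim]
  congr 2
  · refine integral_congr_ae ?_
    filter_upwards [h.ae_pos hα] with x hx
    have e1 : 1 - x / (1 + x) = (1 + x)⁻¹ := by field_simp; ring
    have e2 : 2 - x / (1 + x) = 1 + (1 + x)⁻¹ := by field_simp; ring
    rw [squash_of_nonneg hx.le, squash_of_nonneg (by positivity), e1, e2]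
  · refine integral_congr_ae ?_
    filter_upwards [h.ae_pos hα] with x hx
    rw [squash_of_nonneg hx.le, squash_of_nonneg (by positivity)]
    congr 1
    field_simp
    ring

/-- `ν_α` is stationary for the random walk which applies `x ↦ 1 / (1 + x)` with probability `1 - α`
and `x ↦ 1 + 1 / x` with probability `α`. -/
lemma eq_map_add_map (h : IsSternBrocotMeasure α ν) (hα : α ∈ Icc (0 : ℝ) 1) :
    ν = ENNReal.ofReal (1 - α) • ν.map (fun x => (1 + x)⁻¹)
      + ENNReal.ofReal α • ν.map (fun x => 1 + x⁻¹) := by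
  have := h.1
  have hm1 : Measurable fun x : ℝ => (1 + x)⁻¹ := by fun_prop
  have hm2 : Measurable fun x : ℝ => 1 + x⁻¹ := by fun_prop
  have hs := continuous_squash.measurable
  have : IsFiniteMeasure (ENNReal.ofReal (1 - α) • ν.map (fun x => (1 + x)⁻¹)) :=
    Measure.smul_finite _ ENNReal.ofReal_ne_top
  have : IsFiniteMeasure (ENNReal.ofReal α • ν.map (fun x => 1 + x⁻¹)) :=
    Measure.smul_finite _ ENNReal.ofReal_ne_top
  set μ := ENNReal.ofReal (1 - α) • ν.map (fun x => (1 + x)⁻¹)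
      + ENNReal.ofReal α • ν.map (fun x => 1 + x⁻¹) with hμ
  have hmap : ν.map squash = μ.map squash := by
    refine ext_of_forall_integral_eq_of_IsFiniteMeasure fun g => ?_
    have hint : ∀ (ρ : Measure ℝ) [IsFiniteMeasure ρ], Integrable (fun x => g (squash x)) ρ :=
      fun ρ _ => (g.compContinuous ⟨squash, continuous_squash⟩).integrable ρ
    have hgs : StronglyMeasurable fun x => g (squash x) :=
      (g.continuous.comp continuous_squash).stronglyMeasurable
    rw [integral_map hs.aemeasurable g.continuous.aestronglyMeasurable,
      integral_map hs.aemeasurable g.continuous.aestronglyMeasurable,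
      h.integral_comp_squash_eq hα g.continuous.continuousOn, hμ,
      integral_add_measure (hint _) (hint _), integral_smul_measure, integral_smul_measure,
      integral_map hm1.aemeasurable hgs.aestronglyMeasurable,
      integral_map hm2.aemeasurable hgs.aestronglyMeasurable,
      ENNReal.toReal_ofReal (by linarith [hα.2]), ENNReal.toReal_ofReal hα.1, smul_eq_mul,
      smul_eq_mul]
  have hv : Measurable fun t : ℝ => t / (1 - |t|) := by fun_prop
  have := congrArg (Measure.map fun t : ℝ => t / (1 - |t|)) hmap
  rwa [Measure.map_map hv hs, Measure.map_map hv hs, squash_leftInverse.comp_eq_id,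
    Measure.map_id, Measure.map_id] at this

end IsSternBrocotMeasure

lemma integrable_of_forall_integral_min_le {X : Type*} [MeasurableSpace X] {μ : Measure X}
    [IsFiniteMeasure μ] {f : X → ℝ} (hf : Measurable f) (h0 : ∀ᵐ x ∂μ, 0 ≤ f x) {C : ℝ}
    (hC : ∀ N : ℕ, ∫ x, min (f x) N ∂μ ≤ C) : Integrable f μ := by
  have hcover : AECover μ atTop fun N : ℕ => {x | f x ≤ N} :=
    { ae_eventually_mem := ae_of_all _ fun x => by
        obtain ⟨N, hN⟩ := exists_nat_ge (f x)
        filter_upwards [eventually_ge_atTop N] with n hn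
        exact hN.trans (by exact_mod_cast hn)
      measurableSet := fun N => measurableSet_le hf measurable_const }
  have hmin : ∀ N : ℕ, Integrable (fun x => min (f x) N) μ := fun N => by
    refine Integrable.of_bound (C := N) (hf.min measurable_const).aestronglyMeasurable ?_
    filter_upwards [h0] with x hx
    rw [Real.norm_eq_abs, abs_of_nonneg (le_min hx (by positivity))]
    exact min_le_right _ _
  have heq : ∀ N : ℕ, EqOn (fun x => min (f x) N) f {x | f x ≤ N} := fun N x hx => min_eq_left hx
  refine hcover.integrable_of_integral_bounded_of_nonneg_ae C (fun N => ?_) h0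
    (Eventually.of_forall fun N => ?_)
  · exact (hmin N).integrableOn.congr_fun (heq N) (hcover.measurableSet N)
  · rw [← setIntegral_congr_fun (hcover.measurableSet N) (heq N)]
    refine (setIntegral_le_integral (hmin N) ?_).trans (hC N)
    filter_upwards [h0] with x hx
    exact le_min hx (by positivity)

/-- The weight which controls the growth at `0` and `∞` of the functions integrated against
`ν_α`. -/
def tameWeight (x : ℝ) : ℝ := 1 + x + x⁻¹

/-- Measurable functions growing at most like `x` at infinity and `1 / x` at zero. -/
def IsTame (F : ℝ → ℝ) : Prop :=
  Measurable F ∧ ∃ C, ∀ x, 0 < x → |F x| ≤ C * tameWeight x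

lemma one_le_tameWeight {x : ℝ} (hx : 0 < x) : 1 ≤ tameWeight x := by
  have : 0 < x⁻¹ := by positivity
  unfold tameWeight
  linarith

lemma IsTame.comp {F T : ℝ → ℝ} (hF : IsTame F) (hT : Measurable T)
    (hpos : ∀ x, 0 < x → 0 < T x) {D : ℝ}
    (hD : ∀ x, 0 < x → tameWeight (T x) ≤ D * tameWeight x) : IsTame fun x => F (T x) := by
  obtain ⟨hm, C, hC⟩ := hF
  refine ⟨hm.comp hT, C * D, fun x hx => (hC _ (hpos x hx)).trans ?_⟩
  have h1 := hC _ (hpos x hx)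
  have h2 := one_le_tameWeight (hpos x hx)
  have hC0 : 0 ≤ C := by
    by_contra! h
    nlinarith [abs_nonneg (F (T x))]
  rw [mul_assoc]
  exact mul_le_mul_of_nonneg_left (hD x hx) hC0

lemma IsTame.comp_inv_one_add {F : ℝ → ℝ} (hF : IsTame F) : IsTame fun x => F (1 + x)⁻¹ := by
  refine hF.comp (by fun_prop) (fun x hx => by positivity) (D := 3) fun x hx => ?_
  have h1 : (1 + x)⁻¹ ≤ 1 := inv_le_one_of_one_le₀ (by linarith)
  have : 0 < x⁻¹ := by positivity
  simp only [tameWeight, inv_inv]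
  linarith

lemma IsTame.comp_one_add_inv {F : ℝ → ℝ} (hF : IsTame F) : IsTame fun x => F (1 + x⁻¹) := by
  refine hF.comp (by fun_prop) (fun x hx => by positivity) (D := 3) fun x hx => ?_
  have : 0 < x⁻¹ := by positivity
  have h1 : (1 + x⁻¹)⁻¹ ≤ 1 := inv_le_one_of_one_le₀ (by linarith)
  simp only [tameWeight]
  linarith

lemma abs_log_le_add_inv {x : ℝ} (hx : 0 < x) : |Real.log x| ≤ x + x⁻¹ := by
  have h1 := Real.log_le_sub_one_of_pos hx
  have h2 := Real.log_le_sub_one_of_pos (inv_pos.2 hx)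
  have : 0 < x⁻¹ := by positivity
  rw [Real.log_inv] at h2
  rw [abs_le]
  constructor <;> linarith

lemma abs_log_one_add_le {x : ℝ} (hx : 0 ≤ x) : |Real.log (1 + x)| ≤ x := by
  rw [abs_of_nonneg (Real.log_nonneg (by linarith))]
  linarith [Real.log_le_sub_one_of_pos (by linarith : 0 < 1 + x)]

lemma isTame_log : IsTame Real.log :=
  ⟨Real.measurable_log, 1, fun x hx => (abs_log_le_add_inv hx).trans (by
    unfold tameWeight; linarith)⟩

lemma isTame_log_one_add : IsTame fun x => Real.log (1 + x) :=
  ⟨by fun_prop, 1, fun x hx => (abs_log_one_add_le hx.le).trans (by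
    have : 0 < x⁻¹ := by positivity
    unfold tameWeight; linarith)⟩

/-- Measurable functions of two variables which are tame in each variable. -/
def IsTame₂ (F : ℝ → ℝ → ℝ) : Prop :=
  Measurable (Function.uncurry F) ∧
    ∀ x, 0 < x → ∀ y, 0 < y → |F x y| ≤ tameWeight x * tameWeight y

lemma IsTame₂.right {F : ℝ → ℝ → ℝ} (hF : IsTame₂ F) {x : ℝ} (hx : 0 < x) : IsTame (F x) :=
  ⟨hF.1.of_uncurry_left, tameWeight x, hF.2 x hx⟩

lemma isTame₂_log_one_add_mul : IsTame₂ fun x y => Real.log (1 + x * y) := by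
  refine ⟨by unfold Function.uncurry; fun_prop, fun x hx y hy => ?_⟩
  refine (abs_log_one_add_le (by positivity)).trans ?_
  have : 0 < x⁻¹ := by positivity
  have : 0 < y⁻¹ := by positivity
  refine mul_le_mul ?_ ?_ hy.le (by unfold tameWeight; positivity) <;>
    (unfold tameWeight; linarith)

lemma isTame₂_log_add_add_one : IsTame₂ fun x y => Real.log (x + y + 1) := by
  refine ⟨by unfold Function.uncurry; fun_prop, fun x hx y hy => ?_⟩
  simp only [add_comm (x + y)]
  refine (abs_log_one_add_le (by positivity)).trans ?_
  have : 0 < x⁻¹ := by positivity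
  have : 0 < y⁻¹ := by positivity
  have h1 : 0 ≤ tameWeight x - (1 + x) := by unfold tameWeight; linarith
  have h2 : 0 ≤ tameWeight y - (1 + y) := by unfold tameWeight; linarith
  nlinarith [mul_pos hx hy, mul_nonneg h1 h2, mul_nonneg h1 hy.le, mul_nonneg h2 hx.le]

lemma isTame₂_log_add_add_mul : IsTame₂ fun x y => Real.log (x + y + x * y) := by
  refine ⟨by unfold Function.uncurry; fun_prop, fun x hx y hy => ?_⟩
  refine (abs_log_le_add_inv (by positivity)).trans ?_
  have : 0 < x⁻¹ := by positivity
  have : 0 < y⁻¹ := by positivity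
  have h1 : (x + y + x * y)⁻¹ ≤ y⁻¹ := by
    gcongr
    nlinarith [mul_pos hx hy]
  have h2 : x + y + x * y + y⁻¹ ≤ tameWeight x * tameWeight y := by
    have : tameWeight x * tameWeight y = x + y + x * y + y⁻¹
        + (1 + x * y⁻¹ + x⁻¹ + x⁻¹ * y + x⁻¹ * y⁻¹) := by
      unfold tameWeight; ring
    have : 0 ≤ 1 + x * y⁻¹ + x⁻¹ + x⁻¹ * y + x⁻¹ * y⁻¹ := by positivity
    linarith
  linarith

namespace IsSternBrocotMeasure

variable {α : ℝ} {ν : Measure ℝ}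

lemma integral_eq (h : IsSternBrocotMeasure α ν) (hα : α ∈ Icc (0 : ℝ) 1) {F : ℝ → ℝ}
    (hF : Measurable F) (h1 : Integrable (fun x => F (1 + x)⁻¹) ν)
    (h2 : Integrable (fun x => F (1 + x⁻¹)) ν) :
    ∫ x, F x ∂ν = (1 - α) * ∫ x, F (1 + x)⁻¹ ∂ν + α * ∫ x, F (1 + x⁻¹) ∂ν := by
  have hm1 : Measurable fun x : ℝ => (1 + x)⁻¹ := by fun_prop
  have hm2 : Measurable fun x : ℝ => 1 + x⁻¹ := by fun_prop
  have hFs := hF.stronglyMeasurable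
  conv_lhs => rw [h.eq_map_add_map hα]
  rw [integral_add_measure, integral_smul_measure, integral_smul_measure,
      integral_map hm1.aemeasurable hFs.aestronglyMeasurable,
      integral_map hm2.aemeasurable hFs.aestronglyMeasurable,
      ENNReal.toReal_ofReal (by linarith [hα.2]), ENNReal.toReal_ofReal hα.1, smul_eq_mul,
      smul_eq_mul]
  · exact ((integrable_map_measure hFs.aestronglyMeasurable hm1.aemeasurable).2 h1).smul_measure
      ENNReal.ofReal_ne_top
  · exact ((integrable_map_measure hFs.aestronglyMeasurable hm2.aemeasurable).2 h2).smul_measure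
      ENNReal.ofReal_ne_top

lemma integral_min_le (h : IsSternBrocotMeasure α ν) (hα : α ∈ Icc (0 : ℝ) 1) (N : ℕ) :
    ∫ x, min x N ∂ν ≤ 3 ∧ ∫ x, min x⁻¹ N ∂ν ≤ 3 := by
  have := h.1
  have hint : ∀ {f : ℝ → ℝ}, Measurable f → (∀ x, 0 < x → 0 ≤ f x) →
      Integrable (fun x => min (f x) N) ν := fun {f} hf hf0 => by
    refine Integrable.of_bound (C := N) (hf.min measurable_const).aestronglyMeasurable ?_
    filter_upwards [h.ae_pos hα] with x hx
    rw [Real.norm_eq_abs, abs_of_nonneg (le_min (hf0 x hx) (by positivity))]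
    exact min_le_right _ _
  have hN : (0 : ℝ) ≤ N := by positivity
  have i1 := hint (f := fun x => x) (by fun_prop) fun x hx => hx.le
  have i2 := hint (f := fun x => x⁻¹) (by fun_prop) fun x hx => by positivity
  have i3 := hint (f := fun x => (1 + x)⁻¹) (by fun_prop) fun x hx => by positivity
  have i4 := hint (f := fun x => 1 + x⁻¹) (by fun_prop) fun x hx => by positivity
  have i5 := hint (f := fun x => ((1 + x)⁻¹)⁻¹) (by fun_prop) fun x hx => by positivity
  have i6 := hint (f := fun x => (1 + x⁻¹)⁻¹) (by fun_prop) fun x hx => by positivity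
  have e1 := h.integral_eq hα (F := fun x => min x (N : ℝ)) (by fun_prop) i3 i4
  have e2 := h.integral_eq hα (F := fun x => min x⁻¹ (N : ℝ)) (by fun_prop) i5 i6
  have l3 : ∫ x, min (1 + x)⁻¹ (N : ℝ) ∂ν ≤ 1 := by
    have := integral_mono_ae i3 (integrable_const (1 : ℝ)) (by
      filter_upwards [h.ae_pos hα] with x hx
      exact (min_le_left _ _).trans (inv_le_one_of_one_le₀ (by linarith)))
    simpa using this
  have l6 : ∫ x, min (1 + x⁻¹)⁻¹ (N : ℝ) ∂ν ≤ 1 := by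
    have := integral_mono_ae i6 (integrable_const (1 : ℝ)) (by
      filter_upwards [h.ae_pos hα] with x hx
      have : 0 < x⁻¹ := by positivity
      exact (min_le_left _ _).trans (inv_le_one_of_one_le₀ (by linarith)))
    simpa using this
  have hmin : ∀ t : ℝ, min (1 + t) (N : ℝ) ≤ 1 + min t N := fun t => by
    rw [← min_add_add_left]
    exact min_le_min_left _ (by linarith)
  have l4 : ∫ x, min (1 + x⁻¹) (N : ℝ) ∂ν ≤ 1 + ∫ x, min x⁻¹ (N : ℝ) ∂ν := by
    have := integral_mono i4 ((integrable_const (1 : ℝ)).add i2) fun x => hmin x⁻¹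
    simpa [integral_add (integrable_const (1 : ℝ)) i2] using this
  have l5 : ∫ x, min ((1 + x)⁻¹)⁻¹ (N : ℝ) ∂ν ≤ 1 + ∫ x, min x (N : ℝ) ∂ν := by
    have := integral_mono i5 ((integrable_const (1 : ℝ)).add i1) fun x => by
      simpa using hmin x
    simpa [integral_add (integrable_const (1 : ℝ)) i1] using this
  have n1 : 0 ≤ ∫ x, min x (N : ℝ) ∂ν := integral_nonneg_of_ae (by
    filter_upwards [h.ae_pos hα] with x hx using le_min hx.le hN)
  have n2 : 0 ≤ ∫ x, min x⁻¹ (N : ℝ) ∂ν := integral_nonneg_of_ae (by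
    filter_upwards [h.ae_pos hα] with x hx using le_min (by positivity) hN)
  set a := ∫ x, min x (N : ℝ) ∂ν
  set b := ∫ x, min x⁻¹ (N : ℝ) ∂ν
  have h0 : 0 ≤ 1 - α := by linarith [hα.2]
  have b1 : a ≤ 1 + α * b := by
    nlinarith [mul_le_mul_of_nonneg_left l3 h0, mul_le_mul_of_nonneg_left l4 hα.1]
  have b2 : b ≤ 1 + (1 - α) * a := by
    nlinarith [mul_le_mul_of_nonneg_left l5 h0, mul_le_mul_of_nonneg_left l6 hα.1]
  have hq : α * (1 - α) ≤ 1 / 4 := by nlinarith [sq_nonneg (α - 1 / 2)]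
  constructor
  · nlinarith [mul_le_mul_of_nonneg_left b2 hα.1, mul_le_mul_of_nonneg_right hq n1, hα.2]
  · nlinarith [mul_le_mul_of_nonneg_left b1 h0, mul_le_mul_of_nonneg_right hq n2, hα.1]

lemma integrable_id (h : IsSternBrocotMeasure α ν) (hα : α ∈ Icc (0 : ℝ) 1) :
    Integrable (fun x => x) ν :=
  have := h.1
  integrable_of_forall_integral_min_le measurable_id h.ae_nonneg
    fun N => (h.integral_min_le hα N).1

lemma integrable_inv (h : IsSternBrocotMeasure α ν) (hα : α ∈ Icc (0 : ℝ) 1) :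
    Integrable (fun x => x⁻¹) ν :=
  have := h.1
  integrable_of_forall_integral_min_le measurable_inv
    (h.ae_nonneg.mono fun _ hx => inv_nonneg.2 hx) fun N => (h.integral_min_le hα N).2

lemma integrable_tameWeight (h : IsSternBrocotMeasure α ν) (hα : α ∈ Icc (0 : ℝ) 1) :
    Integrable tameWeight ν :=
  have := h.1
  ((integrable_const (1 : ℝ)).add (h.integrable_id hα)).add (h.integrable_inv hα)

lemma integrable (h : IsSternBrocotMeasure α ν) (hα : α ∈ Icc (0 : ℝ) 1) {F : ℝ → ℝ}
    (hF : IsTame F) : Integrable F ν := by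
  obtain ⟨hm, C, hC⟩ := hF
  refine ((h.integrable_tameWeight hα).const_mul C).mono' hm.aestronglyMeasurable ?_
  filter_upwards [h.ae_pos hα] with x hx using hC x hx

lemma integral_eq_of_isTame (h : IsSternBrocotMeasure α ν) (hα : α ∈ Icc (0 : ℝ) 1) {F : ℝ → ℝ}
    (hF : IsTame F) :
    ∫ x, F x ∂ν = (1 - α) * ∫ x, F (1 + x)⁻¹ ∂ν + α * ∫ x, F (1 + x⁻¹) ∂ν :=
  h.integral_eq hα hF.1 (h.integrable hα hF.comp_inv_one_add) (h.integrable hα hF.comp_one_add_inv)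

lemma isTame_integral (h : IsSternBrocotMeasure α ν) (hα : α ∈ Icc (0 : ℝ) 1) {F : ℝ → ℝ → ℝ}
    (hF : IsTame₂ F) : IsTame fun x => ∫ y, F x y ∂ν := by
  have := h.1
  refine ⟨(hF.1.stronglyMeasurable.integral_prod_right).measurable,
    ∫ y, tameWeight y ∂ν, fun x hx => ?_⟩
  have := norm_integral_le_of_norm_le (f := F x)
    ((h.integrable_tameWeight hα).const_mul (tameWeight x)) (by
      filter_upwards [h.ae_pos hα] with y hy using hF.2 x hx y hy)
  rwa [integral_const_mul, mul_comm] at this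

lemma integrable_prod (h : IsSternBrocotMeasure α ν) (hα : α ∈ Icc (0 : ℝ) 1) {F : ℝ → ℝ → ℝ}
    (hF : IsTame₂ F) : Integrable (fun q : ℝ × ℝ => F q.1 q.2) (ν.prod ν) := by
  have := h.1
  have hw := h.integrable_tameWeight hα
  refine (hw.mul_prod hw).mono' hF.1.aestronglyMeasurable ?_
  filter_upwards [Measure.quasiMeasurePreserving_fst.ae (h.ae_pos hα),
    Measure.quasiMeasurePreserving_snd.ae (h.ae_pos hα)] with q h1 h2 using hF.2 _ h1 _ h2

end IsSternBrocotMeasure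

/-- The kernel `log ((x + y + xy) / (x + y + 1))` integrated in `y`, with `x` expressed in the
coordinate `u = squash x`. -/
def squashKernel (ν : Measure ℝ) (u : ℝ) : ℝ :=
  ∫ y, Real.log ((u + y) / (1 + y * (1 - u))) ∂ν

namespace IsSternBrocotMeasure

variable {α β : ℝ} {ν μ : Measure ℝ}

lemma continuousOn_squashKernel (h : IsSternBrocotMeasure α ν) (hα : α ∈ Icc (0 : ℝ) 1) :
    ContinuousOn (squashKernel ν) (Icc 0 1) := by
  refine continuousOn_of_dominated (bound := fun y => 2 * tameWeight y)
    (fun u _ => by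
      have : Measurable fun y => Real.log ((u + y) / (1 + y * (1 - u))) := by fun_prop
      exact this.aestronglyMeasurable) (fun u hu => ?_)
    ((h.integrable_tameWeight hα).const_mul 2) ?_
  · filter_upwards [h.ae_pos hα] with y hy
    have hu1 : 0 ≤ 1 - u := by linarith [hu.2]
    have h0 : 0 ≤ y * (1 - u) := by positivity
    have h1 : 0 < u + y := by linarith [hu.1]
    have hy' : 0 < y⁻¹ := by positivity
    have hinv : (u + y)⁻¹ ≤ y⁻¹ := by
      gcongr
      linarith [hu.1]
    rw [Real.log_div h1.ne' (by positivity), Real.norm_eq_abs]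
    refine (abs_sub _ _).trans ?_
    have b1 := abs_log_le_add_inv h1
    have b2 := abs_log_one_add_le h0
    have b3 : y * (1 - u) ≤ y := by nlinarith [hu.1]
    unfold tameWeight
    linarith [hu.2]
  · filter_upwards [h.ae_pos hα] with y hy u hu
    have hu1 : 0 ≤ 1 - u := by linarith [hu.2]
    have h0 : 0 < 1 + y * (1 - u) := by positivity
    have h1 : 0 < u + y := by linarith [hu.1]
    refine ContinuousAt.continuousWithinAt ?_
    refine ContinuousAt.log (ContinuousAt.div (by fun_prop) (by fun_prop) h0.ne') ?_
    positivity

lemma squashKernel_squash (h : IsSternBrocotMeasure α ν) (hα : α ∈ Icc (0 : ℝ) 1) {x : ℝ}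
    (hx : 0 < x) :
    squashKernel ν (squash x) =
      ∫ y, Real.log (x + y + x * y) ∂ν - ∫ y, Real.log (x + y + 1) ∂ν := by
  rw [← integral_sub (h.integrable hα (isTame₂_log_add_add_mul.right hx))
    (h.integrable hα (isTame₂_log_add_add_one.right hx)), squashKernel]
  refine integral_congr_ae ?_
  filter_upwards [h.ae_pos hα] with y hy
  rw [← Real.log_div (by positivity) (by positivity), squash_of_nonneg hx.le]
  congr 1
  have : (1 + x) - x = 1 := by ring
  rw [one_sub_div (by positivity), this]
  field_simp
  ring_nf

lemma integral_prod_log (h : IsSternBrocotMeasure α ν) (hα : α ∈ Icc (0 : ℝ) 1) :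
    ∫ q : ℝ × ℝ, Real.log ((q.1 + q.2 + q.1 * q.2) / (q.1 + q.2 + 1)) ∂(ν.prod ν)
      = ∫ x, squashKernel ν (squash x) ∂ν := by
  have := h.1
  have i1 := h.integrable_prod hα isTame₂_log_add_add_mul
  have i2 := h.integrable_prod hα isTame₂_log_add_add_one
  have e : ∀ᵐ q : ℝ × ℝ ∂(ν.prod ν),
      Real.log ((q.1 + q.2 + q.1 * q.2) / (q.1 + q.2 + 1))
        = Real.log (q.1 + q.2 + q.1 * q.2) - Real.log (q.1 + q.2 + 1) := by
    filter_upwards [Measure.quasiMeasurePreserving_fst.ae (h.ae_pos hα),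
      Measure.quasiMeasurePreserving_snd.ae (h.ae_pos hα)] with q h1 h2
    rw [Real.log_div (by positivity) (by positivity)]
  rw [integral_congr_ae e, integral_sub i1 i2, integral_prod _ i1, integral_prod _ i2,
    ← integral_sub i1.integral_prod_left i2.integral_prod_left]
  refine integral_congr_ae ?_
  filter_upwards [h.ae_pos hα] with x hx
  exact (h.squashKernel_squash hα hx).symm

lemma integral_log (h : IsSternBrocotMeasure α ν) (hα : α ∈ Icc (0 : ℝ) 1) :
    (1 + α) * ∫ x, Real.log x ∂ν = (2 * α - 1) * ∫ x, Real.log (1 + x) ∂ν := by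
  have h1 : ∫ x, Real.log (1 + x)⁻¹ ∂ν = -∫ x, Real.log (1 + x) ∂ν := by
    simp only [Real.log_inv, integral_neg]
  have h2 : ∫ x, Real.log (1 + x⁻¹) ∂ν = ∫ x, Real.log (1 + x) ∂ν - ∫ x, Real.log x ∂ν := by
    rw [← integral_sub (h.integrable hα isTame_log_one_add) (h.integrable hα isTame_log)]
    refine integral_congr_ae ?_
    filter_upwards [h.ae_pos hα] with x hx
    rw [← Real.log_div (by positivity) (by positivity)]
    congr 1
    field_simp
    ring
  have h3 := h.integral_eq_of_isTame hα isTame_log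
  rw [h1, h2] at h3
  linarith

/-- Stationarity of `ν_α`, applied to `y ↦ log (1 + x y)`. -/
lemma integral_log_one_add_mul (h : IsSternBrocotMeasure α ν) (hα : α ∈ Icc (0 : ℝ) 1) {x : ℝ}
    (hx : 0 < x) :
    ∫ y, Real.log (1 + x * y) ∂ν =
      (1 - α) * (∫ y, Real.log (x + y + 1) ∂ν - ∫ y, Real.log (1 + y) ∂ν)
        + α * (∫ y, Real.log (x + y + x * y) ∂ν - ∫ y, Real.log y ∂ν) := by
  rw [h.integral_eq_of_isTame hα (isTame₂_log_one_add_mul.right hx),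
    ← integral_sub (h.integrable hα (isTame₂_log_add_add_one.right hx))
      (h.integrable hα isTame_log_one_add),
    ← integral_sub (h.integrable hα (isTame₂_log_add_add_mul.right hx))
      (h.integrable hα isTame_log)]
  congr 2 <;> refine integral_congr_ae ?_ <;> filter_upwards [h.ae_pos hα] with y hy <;>
    rw [← Real.log_div (by positivity) (by positivity)] <;> congr 1 <;> field_simp <;> ring

lemma integral_log_one_add_inv_one_add_mul (h : IsSternBrocotMeasure α ν)
    (hα : α ∈ Icc (0 : ℝ) 1) {x : ℝ} (hx : 0 < x) :
    ∫ y, Real.log (1 + (1 + x)⁻¹ * y) ∂ν =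
      ∫ y, Real.log (x + y + 1) ∂ν - Real.log (1 + x) := by
  have := h.1
  have hc : ∫ _, Real.log (1 + x) ∂ν = Real.log (1 + x) := by simp
  rw [← hc, ← integral_sub (h.integrable hα (isTame₂_log_add_add_one.right hx))
    (integrable_const _)]
  refine integral_congr_ae ?_
  filter_upwards [h.ae_pos hα] with y hy
  rw [← Real.log_div (by positivity) (by positivity)]
  congr 1
  field_simp
  ring

lemma integral_log_one_add_one_add_inv_mul (h : IsSternBrocotMeasure α ν)
    (hα : α ∈ Icc (0 : ℝ) 1) {x : ℝ} (hx : 0 < x) :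
    ∫ y, Real.log (1 + (1 + x⁻¹) * y) ∂ν =
      ∫ y, Real.log (x + y + x * y) ∂ν - Real.log x := by
  have := h.1
  have hc : ∫ _, Real.log x ∂ν = Real.log x := by simp
  rw [← hc, ← integral_sub (h.integrable hα (isTame₂_log_add_add_mul.right hx))
    (integrable_const _)]
  refine integral_congr_ae ?_
  filter_upwards [h.ae_pos hα] with y hy
  rw [← Real.log_div (by positivity) (by positivity)]
  congr 1
  field_simp
  ring

/-- The comparison of `ν_α` and `ν_β`, obtained by computing `∬ log (1 + x y) dν_α(y) dν_β(x)` in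
two ways, with the stationarity of either measure. -/
lemma sub_mul_integral_squashKernel (h : IsSternBrocotMeasure α ν) (hα : α ∈ Icc (0 : ℝ) 1)
    (h' : IsSternBrocotMeasure β μ) (hβ : β ∈ Icc (0 : ℝ) 1) :
    (β - α) * ∫ x, squashKernel ν (squash x) ∂μ =
      ((1 - β) * ∫ x, Real.log (1 + x) ∂μ + β * ∫ x, Real.log x ∂μ)
        - ((1 - α) * ∫ x, Real.log (1 + x) ∂ν + α * ∫ x, Real.log x ∂ν) := by
  have := h'.1
  have iU := h'.integrable hβ (h.isTame_integral hα isTame₂_log_add_add_one)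
  have iV := h'.integrable hβ (h.isTame_integral hα isTame₂_log_add_add_mul)
  have iL := h'.integrable hβ isTame_log_one_add
  have iG := h'.integrable hβ isTame_log
  have iU' : Integrable (fun x => (1 - α) *
      (∫ y, Real.log (x + y + 1) ∂ν - ∫ y, Real.log (1 + y) ∂ν)) μ :=
    (iU.sub (integrable_const _)).const_mul _
  have iV' : Integrable (fun x => α *
      (∫ y, Real.log (x + y + x * y) ∂ν - ∫ y, Real.log y ∂ν)) μ :=
    (iV.sub (integrable_const _)).const_mul _
  have e1 : ∫ x, ∫ y, Real.log (1 + x * y) ∂ν ∂μ =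
      (1 - α) * (∫ x, ∫ y, Real.log (x + y + 1) ∂ν ∂μ - ∫ y, Real.log (1 + y) ∂ν)
        + α * (∫ x, ∫ y, Real.log (x + y + x * y) ∂ν ∂μ - ∫ y, Real.log y ∂ν) := by
    rw [integral_congr_ae ((h'.ae_pos hβ).mono fun x hx => h.integral_log_one_add_mul hα hx),
      integral_add iU' iV', integral_const_mul, integral_const_mul,
      integral_sub iU (integrable_const _), integral_sub iV (integrable_const _)]
    simp
  have e2 := h'.integral_eq_of_isTame hβ (h.isTame_integral hα isTame₂_log_one_add_mul)
  rw [integral_congr_ae ((h'.ae_pos hβ).mono fun x hx =>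
      h.integral_log_one_add_inv_one_add_mul hα hx),
    integral_congr_ae ((h'.ae_pos hβ).mono fun x hx =>
      h.integral_log_one_add_one_add_inv_mul hα hx), integral_sub iU iL, integral_sub iV iG] at e2
  rw [integral_congr_ae ((h'.ae_pos hβ).mono fun x hx => h.squashKernel_squash hα hx),
    integral_sub iV iU]
  linarith

lemma integral_log_eq (h : IsSternBrocotMeasure α ν) (hα : α ∈ Ioc (1 / 2 : ℝ) 1)
    (h' : IsSternBrocotMeasure β μ) (hβ : β ∈ Ioc (1 / 2 : ℝ) 1) :
    ∫ x, Real.log x ∂μ = (2 * β - 1) / (β ^ 2 - β + 1) *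
      ((β - α) * ∫ x, squashKernel ν (squash x) ∂μ
        + (∫ x, Real.log x ∂ν) * (α ^ 2 - α + 1) / (2 * α - 1)) := by
  have hα' : α ∈ Icc (0 : ℝ) 1 := ⟨by linarith [hα.1], hα.2⟩
  have hβ' : β ∈ Icc (0 : ℝ) 1 := ⟨by linarith [hβ.1], hβ.2⟩
  have a0 : 0 < 2 * α - 1 := by linarith [hα.1]
  have hB : 0 < β ^ 2 - β + 1 := by nlinarith [sq_nonneg (β - 1 / 2)]
  have key := h.sub_mul_integral_squashKernel hα' h' hβ'
  have l : (1 - α) * ∫ x, Real.log (1 + x) ∂ν + α * ∫ x, Real.log x ∂ν =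
      (∫ x, Real.log x ∂ν) * (α ^ 2 - α + 1) / (2 * α - 1) := by
    rw [eq_div_iff a0.ne']
    linear_combination (α - 1) * h.integral_log hα'
  rw [key, l, sub_add_cancel, div_mul_eq_mul_div, eq_div_iff hB.ne']
  linear_combination (1 - β) * h'.integral_log hβ'

end IsSternBrocotMeasure

lemma ContinuousWithinAt.hasDerivWithinAt_sub_mul {K : ℝ → ℝ} {s : Set ℝ} {a : ℝ}
    (hK : ContinuousWithinAt K s a) : HasDerivWithinAt (fun b => (b - a) * K b) (K a) s a := by
  rw [hasDerivWithinAt_iff_tendsto_slope]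
  refine (hK.mono sdiff_subset).congr' ?_
  filter_upwards [self_mem_nhdsWithin] with b hb
  have : b - a ≠ 0 := sub_ne_zero.2 hb.2
  simp [slope_def_field, this]

/-- Derivative of `γ(β) = ∫ log x dν_β(x)` at any `α ∈ (1/2,1]` within `(1/2,1]`:
`γ'(α) = γ(α)·(1+2α-2α²)/((2α-1)(α²-α+1))
        + ((2α-1)/(α²-α+1))·∬ log((x+y+xy)/(x+y+1)) dν_α(x)dν_α(y)`. -/
theorem gamma_hasDerivWithinAt
    (ν : ℝ → Measure ℝ) (hν : ∀ β ∈ Set.Icc (0 : ℝ) 1, IsSternBrocotMeasure β (ν β))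
    (α : ℝ) (hα0 : 1 / 2 < α) (hα1 : α ≤ 1) :
    HasDerivWithinAt (fun β : ℝ => ∫ x, Real.log x ∂(ν β))
      ((∫ x, Real.log x ∂(ν α)) * (1 + 2 * α - 2 * α ^ 2) / ((2 * α - 1) * (α ^ 2 - α + 1))
        + ((2 * α - 1) / (α ^ 2 - α + 1)) *
          ∫ q : ℝ × ℝ, Real.log ((q.1 + q.2 + q.1 * q.2) / (q.1 + q.2 + 1))
            ∂((ν α).prod (ν α)))
      (Set.Ioc (1 / 2) 1) α := by
  have hα : α ∈ Ioc (1 / 2 : ℝ) 1 := ⟨hα0, hα1⟩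
  have hsub : Ioc (1 / 2 : ℝ) 1 ⊆ Icc 0 1 := fun β hβ => ⟨by linarith [hβ.1], hβ.2⟩
  have h := hν α (hsub hα)
  have a0 : 0 < 2 * α - 1 := by linarith
  have hD : 0 < α ^ 2 - α + 1 := by nlinarith [sq_nonneg (α - 1 / 2)]
  rw [h.integral_prod_log (hsub hα)]
  have hK : ContinuousWithinAt (fun β => ∫ x, squashKernel (ν α) (squash x) ∂(ν β))
      (Ioc (1 / 2) 1) α :=
    (continuousOn_integral_comp_squash hν (h.continuousOn_squashKernel (hsub hα)) α
      (hsub hα)).mono hsub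
  have hq : HasDerivAt (fun β : ℝ => (2 * β - 1) / (β ^ 2 - β + 1))
      ((2 * (α ^ 2 - α + 1) - (2 * α - 1) * (2 * α - 1)) / (α ^ 2 - α + 1) ^ 2) α := by
    have h1 : HasDerivAt (fun β : ℝ => 2 * β - 1) 2 α := by
      simpa using ((hasDerivAt_id α).const_mul 2).sub_const 1
    have h2 : HasDerivAt (fun β : ℝ => β ^ 2 - β + 1) (2 * α - 1) α := by
      simpa using ((hasDerivAt_pow 2 α).sub (hasDerivAt_id α)).add_const 1
    exact h1.div h2 hD.ne'
  have hmain := (hq.hasDerivWithinAt (s := Ioc (1 / 2) 1)).mul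
    (hK.hasDerivWithinAt_sub_mul.add_const
      ((∫ x, Real.log x ∂(ν α)) * (α ^ 2 - α + 1) / (2 * α - 1)))
  refine (hmain.congr (fun β hβ => h.integral_log_eq hα (hν β (hsub hβ)) hβ)
    (h.integral_log_eq hα h hα)).congr_deriv ?_
  have hD' : α * (α - 1) + 1 ≠ 0 := by linarith
  field_simp
  ring
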